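/- (General utility of the histogram estimator) There exists a constant C_L > 0 depending only on L such that for all x0 ∈ [0,1] and all L-Lipschitz densities π on [0,1], E[(π̂ʰⁱˢᵗ(X)(x0) - π(x0))²] ≤ C_L (h² + 1/(n h) + V(Z)/(n² h²)). -/

import Mathlib

open MeasureTheory Set

noncomputable def binIdx (k : ℕ) (x : ℝ) : ℕ := min (Int.toNat ⌊x * k⌋) (k - 1)

noncomputable def binFin (k : ℕ) (hk : 0 < k) (x : ℝ) : Fin k :=
  ⟨binIdx k x, lt_of_le_of_lt (min_le_right _ _) (Nat.sub_lt hk one_pos)⟩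

noncomputable def densMeasure (π : ℝ → ℝ) : Measure ℝ :=
  (volume.restrict (Set.Icc (0 : ℝ) 1)).withDensity fun x => ENNReal.ofReal (π x)

noncomputable def histPriv (n k : ℕ) (hk : 0 < k)
    (ω : (Fin n → ℝ) × (Fin k → ℝ)) (x : ℝ) : ℝ :=
  (1 / ((n : ℝ) * (1 / (k : ℝ)))) *
    ((∑ i, if binIdx k (ω.1 i) = binIdx k x then (1 : ℝ) else 0) + ω.2 (binFin k hk x))

open ProbabilityTheory

/-- Bias-variance decomposition of the mean squared error. -/
lemma integral_sub_const_sq_eq {Ω : Type*} [MeasurableSpace Ω] {P : Measure Ω}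
    [IsProbabilityMeasure P] {X : Ω → ℝ} (hX : MemLp X 2 P) (a : ℝ) :
    ∫ ω, (X ω - a) ^ 2 ∂P = Var[X; P] + (∫ ω, X ω ∂P - a) ^ 2 := by
  have h : MemLp (fun ω => X ω - a) 2 P := hX.sub (memLp_const a)
  have h1 := variance_eq_sub h
  rw [variance_sub_const hX.aestronglyMeasurable,
    integral_sub (hX.integrable one_le_two) (integrable_const a)] at h1
  simp only [Pi.pow_apply, integral_const, probReal_univ, one_smul] at h1
  linarith

lemma measurable_binIdx (k : ℕ) : Measurable (binIdx k) := by
  have h : Measurable fun x : ℝ => ⌊x * k⌋ := (measurable_id.mul_const _).floor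
  exact ((measurable_of_countable fun z : ℤ => min z.toNat (k - 1)).comp h)

/-- The points of the unit interval lying in the same bin as `x`. -/
def sameBin (k : ℕ) (x : ℝ) : Set ℝ := {y ∈ Icc (0 : ℝ) 1 | binIdx k y = binIdx k x}

lemma measurableSet_sameBin (k : ℕ) (x : ℝ) : MeasurableSet (sameBin k x) :=
  measurableSet_Icc.inter (measurable_binIdx k (measurableSet_singleton _))

lemma sameBin_subset_Icc_zero_one (k : ℕ) (x : ℝ) : sameBin k x ⊆ Icc 0 1 := fun _ h => h.1

lemma binIdx_lt {k : ℕ} (hk : 0 < k) (x : ℝ) : binIdx k x < k :=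
  (binFin k hk x).isLt

lemma mem_Icc_of_binIdx {k : ℕ} (hk : 0 < k) {y : ℝ} (hy : y ∈ Icc (0 : ℝ) 1) :
    y ∈ Icc ((binIdx k y : ℝ) / k) ((binIdx k y + 1 : ℝ) / k) := by
  have hk' : (0 : ℝ) < k := by exact_mod_cast hk
  have hyk : 0 ≤ y * k := mul_nonneg hy.1 hk'.le
  have hfl : binIdx k y = min ⌊y * k⌋₊ (k - 1) := rfl
  refine ⟨(div_le_iff₀ hk').2 ?_, (le_div_iff₀ hk').2 ?_⟩
  · refine le_trans ?_ (Nat.floor_le hyk)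
    exact_mod_cast hfl ▸ min_le_left _ _
  · rcases le_total ⌊y * k⌋₊ (k - 1) with h | h
    · rw [hfl, min_eq_left h]
      exact (Nat.lt_floor_add_one _).le
    · rw [hfl, min_eq_right h, Nat.cast_sub hk]
      push_cast
      nlinarith [hy.2]

lemma sameBin_subset_Icc {k : ℕ} (hk : 0 < k) (x : ℝ) :
    sameBin k x ⊆ Icc ((binIdx k x : ℝ) / k) ((binIdx k x + 1 : ℝ) / k) := by
  rintro y ⟨hy, hyx⟩
  exact hyx ▸ mem_Icc_of_binIdx hk hy

lemma Ico_subset_sameBin {k : ℕ} (hk : 0 < k) (x : ℝ) :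
    Ico ((binIdx k x : ℝ) / k) ((binIdx k x + 1 : ℝ) / k) ⊆ sameBin k x := by
  have hk' : (0 : ℝ) < k := by exact_mod_cast hk
  have hb := binIdx_lt hk x
  have hb' : (binIdx k x + 1 : ℝ) ≤ k := by exact_mod_cast hb
  rintro y ⟨h1, h2⟩
  rw [div_le_iff₀ hk'] at h1
  rw [lt_div_iff₀ hk'] at h2
  have hfl : ⌊y * k⌋ = (binIdx k x : ℤ) :=
    Int.floor_eq_iff.2 ⟨by exact_mod_cast h1, by exact_mod_cast h2⟩
  refine ⟨⟨?_, ?_⟩, ?_⟩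
  · exact nonneg_of_mul_nonneg_left ((Nat.cast_nonneg _).trans h1) hk'
  · nlinarith
  · rw [binIdx, hfl, Int.toNat_natCast]
    omega

lemma volume_sameBin {k : ℕ} (hk : 0 < k) (x : ℝ) :
    volume (sameBin k x) = ENNReal.ofReal (1 / k) := by
  have h : (binIdx k x + 1 : ℝ) / k - binIdx k x / k = 1 / k := by ring
  apply le_antisymm
  · simpa [Real.volume_Icc, h] using measure_mono (μ := volume) (sameBin_subset_Icc hk x)
  · simpa [Real.volume_Ico, h] using measure_mono (μ := volume) (Ico_subset_sameBin hk x)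

lemma isProbabilityMeasure_densMeasure {π : ℝ → ℝ} (h0 : ∀ x ∈ Icc (0 : ℝ) 1, 0 ≤ π x)
    (h1 : ∫ x in Icc (0 : ℝ) 1, π x = 1) : IsProbabilityMeasure (densMeasure π) := by
  have hint : IntegrableOn π (Icc 0 1) := integrable_of_integral_eq_one h1
  refine ⟨?_⟩
  rw [densMeasure, withDensity_apply _ MeasurableSet.univ, Measure.restrict_univ,
    ← ofReal_integral_eq_lintegral_ofReal hint
      ((ae_restrict_iff' measurableSet_Icc).2 (ae_of_all _ h0)), h1, ENNReal.ofReal_one]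

lemma densMeasure_real_sameBin {π : ℝ → ℝ} (h0 : ∀ x ∈ Icc (0 : ℝ) 1, 0 ≤ π x)
    (hint : IntegrableOn π (Icc 0 1)) (k : ℕ) (x : ℝ) :
    (densMeasure π).real {y | binIdx k y = binIdx k x} = ∫ y in sameBin k x, π y := by
  have hS : MeasurableSet {y | binIdx k y = binIdx k x} :=
    measurable_binIdx k (measurableSet_singleton _)
  rw [measureReal_def, densMeasure, withDensity_apply _ hS, Measure.restrict_restrict hS,
    inter_comm]
  change (∫⁻ y in sameBin k x, _).toReal = _
  have hnn : ∀ y ∈ sameBin k x, 0 ≤ π y := fun y hy => h0 y hy.1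
  rw [← ofReal_integral_eq_lintegral_ofReal (hint.mono_set (sameBin_subset_Icc_zero_one k x))
      ((ae_restrict_iff' (measurableSet_sameBin k x)).2 (ae_of_all _ hnn)),
    ENNReal.toReal_ofReal (setIntegral_nonneg (measurableSet_sameBin k x) hnn)]

/-- The bias of the histogram: the mean of a Lipschitz function over a bin of width `1 / k`
is within `L / k` of its value at any point of the bin. -/
lemma abs_mul_setIntegral_sameBin_sub_le {L : ℝ} (hL : 0 ≤ L) {k : ℕ} (hk : 0 < k) {π : ℝ → ℝ}
    (hint : IntegrableOn π (Icc 0 1))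
    (hlip : ∀ x ∈ Icc (0 : ℝ) 1, ∀ y ∈ Icc (0 : ℝ) 1, |π y - π x| ≤ L * |y - x|)
    {x : ℝ} (hx : x ∈ Icc (0 : ℝ) 1) :
    |k * (∫ y in sameBin k x, π y) - π x| ≤ L * (1 / k) := by
  have hk' : (0 : ℝ) < k := by exact_mod_cast hk
  have hvol : volume.real (sameBin k x) = 1 / k := by
    rw [measureReal_def, volume_sameBin hk, ENNReal.toReal_ofReal (by positivity)]
  have hfin : volume (sameBin k x) < ⊤ := by
    rw [volume_sameBin hk]
    exact ENNReal.ofReal_lt_top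
  have hsub : ∫ y in sameBin k x, (π y - π x) = (∫ y in sameBin k x, π y) - 1 / k * π x := by
    rw [integral_sub (hint.mono_set (sameBin_subset_Icc_zero_one k x))
      (integrableOn_const hfin.ne), setIntegral_const, hvol, smul_eq_mul]
  have hbound : ‖∫ y in sameBin k x, (π y - π x)‖ ≤ L * (1 / k) * volume.real (sameBin k x) := by
    refine norm_setIntegral_le_of_norm_le_const hfin fun y hy => ?_
    refine (hlip x hx y hy.1).trans (mul_le_mul_of_nonneg_left ?_ hL)
    have h1 := sameBin_subset_Icc hk x hy
    have h2 := mem_Icc_of_binIdx hk hx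
    refine (abs_sub_le_of_le_of_le h1.1 h1.2 h2.1 h2.2).trans (le_of_eq ?_)
    ring
  have heq : k * (∫ y in sameBin k x, π y) - π x = k * ∫ y in sameBin k x, (π y - π x) := by
    rw [hsub]
    field_simp
  rw [heq, abs_mul, abs_of_pos hk']
  rw [hvol, Real.norm_eq_abs] at hbound
  calc _ ≤ (k : ℝ) * (L * (1 / k) * (1 / k)) := by gcongr
    _ = L * (1 / k) := by field_simp

/-- A Lipschitz density on the unit interval is bounded by `L + 1`. -/
lemma density_le_add_one {L : ℝ} (hL : 0 ≤ L) {π : ℝ → ℝ}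
    (h1 : ∫ x in Icc (0 : ℝ) 1, π x = 1)
    (hlip : ∀ x ∈ Icc (0 : ℝ) 1, ∀ y ∈ Icc (0 : ℝ) 1, |π y - π x| ≤ L * |y - x|)
    {x : ℝ} (hx : x ∈ Icc (0 : ℝ) 1) : π x ≤ L + 1 := by
  have hint : IntegrableOn π (Icc 0 1) := integrable_of_integral_eq_one h1
  have h : ∫ _ in Icc (0 : ℝ) 1, (π x - L) ≤ ∫ y in Icc (0 : ℝ) 1, π y := by
    refine setIntegral_mono_on (integrableOn_const (by simp)) hint measurableSet_Icc fun y hy => ?_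
    have h2 := (abs_le.1 (hlip x hx y hy)).1
    have h3 : L * |y - x| ≤ L * 1 := mul_le_mul_of_nonneg_left
      (abs_le.2 ⟨by linarith [hy.1, hx.2], by linarith [hy.2, hx.1]⟩) hL
    linarith
  rw [h1] at h
  simp at h
  linarith

/-- General utility of the randomized histogram estimator: there is a constant
`C_L` depending only on `L` such that the pointwise mean squared error is at most
`C_L (h² + 1/(n h) + V(Z)/(n² h²))` with `h = 1/k`. -/
theorem histPriv_mse_le (L : ℝ) (hL : 0 < L) :
    ∃ C : ℝ, 0 < C ∧
      ∀ (n k : ℕ) (hn : 0 < n) (hk : 0 < k)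
        (π : ℝ → ℝ), Measurable π →
        (∀ x ∈ Set.Icc (0 : ℝ) 1, 0 ≤ π x) →
        (∫ x in Set.Icc (0 : ℝ) 1, π x) = 1 →
        (∀ x ∈ Set.Icc (0 : ℝ) 1, ∀ y ∈ Set.Icc (0 : ℝ) 1,
          |π y - π x| ≤ L * |y - x|) →
        ∀ (ν : Measure ℝ), IsProbabilityMeasure ν →
        ∀ V : ℝ, (∫ z, z ∂ν) = 0 → (∫ z, z ^ 2 ∂ν) = V →
          Integrable (fun z => z ^ 2) ν →
        ∀ x0 ∈ Set.Icc (0 : ℝ) 1,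
          (∫ ω, (histPriv n k hk ω x0 - π x0) ^ 2
            ∂((Measure.pi fun _ : Fin n => densMeasure π).prod
                (Measure.pi fun _ : Fin k => ν)))
            ≤ C * ((1 / (k : ℝ)) ^ 2 + 1 / ((n : ℝ) * (1 / (k : ℝ)))
                + V / ((n : ℝ) ^ 2 * (1 / (k : ℝ)) ^ 2)) := by
  refine ⟨L ^ 2 + L + 1, by positivity, ?_⟩
  intro n k hn hk π _ h0 h1 hlip ν _ V hmean hV hsq x0 hx0
  have hn' : (0 : ℝ) < n := by exact_mod_cast hn
  have hk' : (0 : ℝ) < k := by exact_mod_cast hk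
  have hint : IntegrableOn π (Icc 0 1) := integrable_of_integral_eq_one h1
  have := isProbabilityMeasure_densMeasure h0 h1
  set p : ℝ := ∫ y in sameBin k x0, π y with hp
  set S : Set ℝ := {y | binIdx k y = binIdx k x0} with hSdef
  have hS : MeasurableSet S := measurable_binIdx k (measurableSet_singleton _)
  have hpS : (densMeasure π).real S = p := densMeasure_real_sameBin h0 hint k x0
  set f : ℝ → ℝ := fun y => if binIdx k y = binIdx k x0 then 1 else 0 with hf
  have hfS : f = S.indicator 1 := by
    ext y
    simp [hf, hSdef, indicator]
  have hfm : Measurable f := hfS ▸ measurable_one.indicator hS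
  have hf01 : ∀ y, f y ∈ Icc (0 : ℝ) 1 := fun y => by
    simp only [hf]
    split_ifs <;> simp
  have hfL : MemLp f 2 (densMeasure π) :=
    memLp_of_bounded (ae_of_all _ hf01) hfm.aestronglyMeasurable 2
  have hfp : ∫ y, f y ∂densMeasure π = p := by
    rw [hfS, integral_indicator_one hS, hpS]
  have hfvar : Var[f; densMeasure π] ≤ p := by
    refine (variance_le_sub_mul_sub (ae_of_all _ hf01) hfm.aemeasurable).trans ?_
    rw [hfp]
    nlinarith [sq_nonneg p]
  have hZL : MemLp (fun z : ℝ => z) 2 ν :=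
    (memLp_two_iff_integrable_sq measurable_id.aestronglyMeasurable).2 hsq
  have hZvar : Var[fun z : ℝ => z; ν] = V := by
    rw [variance_eq_integral (X := fun z : ℝ => z) measurable_id.aemeasurable, hmean]
    simpa using hV
  set P := Measure.pi fun _ : Fin n => densMeasure π
  set Q := Measure.pi fun _ : Fin k => ν
  set b := binFin k hk x0
  set X : (Fin n → ℝ) → ℝ := fun w => ∑ i, f (w i) with hX
  set Y : (Fin k → ℝ) → ℝ := fun w => w b with hY
  have hfi : ∀ i : Fin n, MemLp (fun w : Fin n → ℝ => f (w i)) 2 P := fun i =>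
    hfL.comp_measurePreserving (measurePreserving_eval _ i)
  have hXL : MemLp X 2 P := memLp_finsetSum _ fun i _ => hfi i
  have hbmp : MeasurePreserving (Function.eval b) Q ν := measurePreserving_eval (fun _ => ν) b
  have hYL : MemLp Y 2 Q := hZL.comp_measurePreserving hbmp
  have hXmean : ∫ w, X w ∂P = n * p := by
    rw [hX, integral_finsetSum _ fun i _ => (hfi i).integrable one_le_two]
    simp [P, integral_comp_eval (μ := fun _ : Fin n => densMeasure π) hfm.aestronglyMeasurable, hfp]
  have hYmean : ∫ w, Y w ∂Q = 0 := by
    rw [← hmean]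
    exact integral_comp_eval (μ := fun _ : Fin k => ν) (f := fun z : ℝ => z)
      measurable_id.aestronglyMeasurable
  have hXvar : Var[X; P] ≤ n * p := by
    have h := variance_sum_pi (μ := fun _ : Fin n => densMeasure π) (X := fun _ => f) fun _ => hfL
    have hXe : X = ∑ i, fun w : Fin n → ℝ => f (w i) := by
      ext w
      simp [hX]
    rw [hXe, h]
    simpa using mul_le_mul_of_nonneg_left hfvar hn'.le
  have hYvar : Var[Y; Q] = V := by
    rw [← hZvar]
    exact hbmp.variance_fun_comp measurable_id.aemeasurable
  set c : ℝ := 1 / ((n : ℝ) * (1 / (k : ℝ))) with hc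
  have hT : MemLp (fun ω : (Fin n → ℝ) × (Fin k → ℝ) => X ω.1 + Y ω.2) 2 (P.prod Q) :=
    (hXL.comp_fst Q).add (hYL.comp_snd P)
  have hTmean : ∫ ω, (X ω.1 + Y ω.2) ∂P.prod Q = n * p := by
    rw [integral_add ((hXL.comp_fst Q).integrable one_le_two)
      ((hYL.comp_snd P).integrable one_le_two), integral_fun_fst, integral_fun_snd]
    simp [hXmean, hYmean]
  have hpriv : (fun ω => histPriv n k hk ω x0) = fun ω => c * (X ω.1 + Y ω.2) := rfl
  have hmse := integral_sub_const_sq_eq (hT.const_mul c) (π x0)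
  rw [variance_const_mul, variance_add_prod hXL hYL, hYvar, integral_const_mul, hTmean] at hmse
  have hcp : c * (n * p) = k * p := by
    rw [hc]
    field_simp
  rw [hcp] at hmse
  have hpk : k * p ≤ L + 1 := by
    have h : p ≤ ∫ _ in sameBin k x0, (L + 1) :=
      setIntegral_mono_on (hint.mono_set (sameBin_subset_Icc_zero_one k x0))
        (integrableOn_const (by simp [volume_sameBin hk])) (measurableSet_sameBin k x0)
        fun y hy => density_le_add_one hL.le h1 hlip hy.1
    rw [setIntegral_const, measureReal_def, volume_sameBin hk,
      ENNReal.toReal_ofReal (by positivity), smul_eq_mul] at h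
    calc k * p ≤ k * (1 / k * (L + 1)) := by gcongr
      _ = L + 1 := by field_simp
  have hbias : (k * p - π x0) ^ 2 ≤ (L * (1 / k)) ^ 2 :=
    sq_le_sq' (abs_le.1 (abs_mul_setIntegral_sameBin_sub_le hL.le hk hint hlip hx0)).1
      (abs_le.1 (abs_mul_setIntegral_sameBin_sub_le hL.le hk hint hlip hx0)).2
  have hV0 : 0 ≤ V := hZvar ▸ variance_nonneg _ _
  have hc0 : 0 < c := by positivity
  have hcV : V / ((n : ℝ) ^ 2 * (1 / (k : ℝ)) ^ 2) = c ^ 2 * V := by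
    rw [hc]
    field_simp
  have hvar : c ^ 2 * Var[X; P] ≤ c * (L + 1) :=
    calc c ^ 2 * Var[X; P] ≤ c ^ 2 * (n * p) := by gcongr
      _ = c * (k * p) := by rw [← hcp]; ring
      _ ≤ c * (L + 1) := by gcongr
  change ∫ ω, (c * (X ω.1 + Y ω.2) - π x0) ^ 2 ∂P.prod Q ≤ _
  rw [hmse, hcV]
  have e1 : 0 ≤ (L + 1) * (1 / (k : ℝ)) ^ 2 := by positivity
  have e2 : 0 ≤ L ^ 2 * c := by positivity
  have e3 : 0 ≤ (L ^ 2 + L) * (c ^ 2 * V) := by positivity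
  linarith
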